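/- For θ = e^{√2}, the set A_θ is empty; that is, for every positive integer n, ⌊1/(e^{√2/n} − 1)⌋ = ⌊n/√2 − 1/2⌋. -/

import Mathlib

/-- The set of atypical numbers `A_θ`, defined via `M'_θ(n) = ⌊1/(θ^{1/n} - 1)⌋`. -/
noncomputable def Atheta (θ : ℝ) : Set ℕ :=
  {n | 0 < n ∧ ⌊(θ ^ ((n : ℝ))⁻¹ - 1)⁻¹⌋ ≠ ⌊(n : ℝ) / Real.log θ - 1 / 2⌋}

theorem inv_sub_half_le_inv_exp_sub_one {x : ℝ} (hx : 0 < x) :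
    x⁻¹ - 1 / 2 ≤ (Real.exp x - 1)⁻¹ := by
  have hu : 0 < Real.exp x - 1 := sub_pos.mpr (Real.one_lt_exp_iff.mpr hx)
  have h := Real.le_log_one_add_of_nonneg hu.le
  rw [add_sub_cancel, Real.log_exp] at h
  generalize Real.exp x - 1 = u at hu h
  have h' := inv_anti₀ (by positivity) h
  have : (2 * u / (u + 2))⁻¹ = 1 / 2 + u⁻¹ := by
    field_simp
  linarith

theorem inv_exp_sub_one_le {x : ℝ} (hx : 0 < x) :
    (Real.exp x - 1)⁻¹ ≤ x⁻¹ - 1 / 2 + x / 12 := by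
  have hu : 0 < Real.exp x - 1 := sub_pos.mpr (Real.one_lt_exp_iff.mpr hx)
  have hq : 0 < 12 - 6 * x + x ^ 2 := by nlinarith [sq_nonneg (x - 3)]
  have h := Real.sum_le_exp_of_nonneg hx.le 6
  norm_num [Finset.sum_range_succ, Nat.factorial] at h
  have hp : 0 ≤ x ^ 5 * (2 - x + x ^ 2) := by
    have : 0 ≤ 2 - x + x ^ 2 := by nlinarith [sq_nonneg (x - 1 / 2)]
    positivity
  have key : 12 * x ≤ (12 - 6 * x + x ^ 2) * (Real.exp x - 1) := by
    nlinarith [mul_le_mul_of_nonneg_left h hq.le]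
  have he : x⁻¹ - 1 / 2 + x / 12 = (12 - 6 * x + x ^ 2) / (12 * x) := by
    field_simp
    ring
  rw [he, inv_eq_one_div, div_le_div_iff₀ hu (by positivity)]
  linarith

/-- A number exceeding `n / √2 - 1 / 2` by at most `√2 / (12 n)` has the same floor, since
`k ^ 2 - 2 * n ^ 2` is an integer for every integer `k`. -/
theorem floor_eq_floor_div_sqrt_two_sub_half {n : ℕ} (hn : 0 < n) {z : ℝ}
    (hl : (n : ℝ) / √2 - 1 / 2 ≤ z) (hr : z ≤ (n : ℝ) / √2 - 1 / 2 + √2 / n / 12) :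
    ⌊z⌋ = ⌊(n : ℝ) / √2 - 1 / 2⌋ := by
  refine le_antisymm ?_ (Int.floor_le_floor hl)
  by_contra! hlt
  have hm := Int.floor_lt.mp hlt
  have hz := (Int.floor_le z).trans hr
  generalize ⌊z⌋ = m at hm hz
  have hn1 : (1 : ℝ) ≤ n := by exact_mod_cast hn
  have hs : √2 * √2 = 2 := Real.mul_self_sqrt (by norm_num)
  have hs0 : 0 < √2 := by positivity
  have hd : (n : ℝ) / √2 = √2 * n / 2 := by
    rw [div_eq_div_iff hs0.ne' two_ne_zero]
    linear_combination -(n : ℝ) * hs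
  rw [hd] at hm hz
  have h1 : √2 * n < 2 * m + 1 := by linarith
  have h2 : (2 * m + 1 : ℝ) ≤ √2 * n + √2 / n / 6 := by linarith
  have hpos : 0 < √2 * n := by positivity
  have lower : 2 * (n : ℝ) ^ 2 < (2 * m + 1) ^ 2 := by
    have := pow_lt_pow_left₀ h1 hpos.le two_ne_zero
    rwa [mul_pow, Real.sq_sqrt (by norm_num)] at this
  have upper : (2 * m + 1 : ℝ) ^ 2 < 2 * (n : ℝ) ^ 2 + 1 := by
    have := pow_le_pow_left₀ (hpos.trans h1).le h2 2
    have e : (√2 * n + √2 / n / 6) ^ 2 = 2 * (n : ℝ) ^ 2 + 2 / 3 + ((n : ℝ) ^ 2)⁻¹ / 18 := by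
      have : (√2 * n + √2 / n / 6) ^ 2 = (√2 * √2) * (n + 1 / n / 6) ^ 2 := by ring
      rw [this, hs]
      field_simp
      ring
    have hi : ((n : ℝ) ^ 2)⁻¹ ≤ 1 := inv_le_one_of_one_le₀ (one_le_pow₀ hn1)
    linarith
  have lower' : 2 * (n : ℤ) ^ 2 < (2 * m + 1) ^ 2 := by exact_mod_cast lower
  have upper' : (2 * m + 1) ^ 2 < 2 * (n : ℤ) ^ 2 + 1 := by exact_mod_cast upper
  linarith [Int.add_one_le_iff.mpr lower']

theorem floor_inv_exp_sqrt_two_div_sub_one {n : ℕ} (hn : 0 < n) :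
    ⌊(Real.exp (√2 / n) - 1)⁻¹⌋ = ⌊(n : ℝ) / √2 - 1 / 2⌋ := by
  have hx : 0 < √2 / (n : ℝ) := by positivity
  have hl := inv_sub_half_le_inv_exp_sub_one hx
  have hr := inv_exp_sub_one_le hx
  rw [inv_div] at hl hr
  exact floor_eq_floor_div_sqrt_two_sub_half hn hl hr

theorem stmt15 :
    Atheta (Real.exp (Real.sqrt 2)) = ∅ ∧
    ∀ n : ℕ, 0 < n →
      ⌊(Real.exp (Real.sqrt 2 / n) - 1)⁻¹⌋ = ⌊(n : ℝ) / Real.sqrt 2 - 1 / 2⌋ := by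
  refine ⟨Set.eq_empty_of_forall_notMem ?_, fun n hn => floor_inv_exp_sqrt_two_div_sub_one hn⟩
  rintro n ⟨hn, hne⟩
  rw [← Real.exp_mul, Real.log_exp, ← div_eq_mul_inv] at hne
  exact hne (floor_inv_exp_sqrt_two_div_sub_one hn)
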